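/- Let E_i be the ELMO component of address i. For every constrained state s of E_i, local_equivocators(s) = local_equivocators_full(s), where local_equivocators(s) is the set of addresses j such that there exist messages m and m' with id(m) = id(m') = j, m ⊥ m', and both m and m' observed in s. -/

import Mathlib

set_option autoImplicit false

universe u v w

/-- A validating labelled state transition and message production system (VLSM):
labels, a nonempty set of initial states, initial messages, a total transition
function and a validity constraint.  `Option M` plays the role of `M ∪ {⊥}`. -/
structure VLSM (L : Type u) (S : Type v) (M : Type w) where
  init : Set S
  init_ne : init.Nonempty
  initMsg : Set M
  tau : L → S → Option M → S × Option M
  beta : L → S → Option M → Prop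

/-- A transition record: label, source state, input message, target state, output message. -/
structure VTrans (L : Type u) (S : Type v) (M : Type w) where
  lbl : L
  src : S
  msg : Option M
  dst : S
  out : Option M

variable {L : Type u} {S : Type v} {M : Type w}

/-- `Chain s tr sf`: the transitions of `tr` link up, starting at `s` and ending at `sf`. -/
def Chain : S → List (VTrans L S M) → S → Prop
  | s, [], sf => s = sf
  | s, t :: ts, sf => t.src = s ∧ Chain t.dst ts sf

namespace VLSM

/-- `t` is an actual transition of `V` (the transition function agrees with `t`). -/
def IsTrans (V : VLSM L S M) (t : VTrans L S M) : Prop :=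
  V.tau t.lbl t.src t.msg = (t.dst, t.out)

/-- `t` is a constrained transition of `V`. -/
def IsConstrainedTrans (V : VLSM L S M) (t : VTrans L S M) : Prop :=
  V.IsTrans t ∧ V.beta t.lbl t.src t.msg

/-- `tr` is a constrained trace of `V` reaching the state `sf`. -/
def ConstrainedTraceTo (V : VLSM L S M) (tr : List (VTrans L S M)) (sf : S) : Prop :=
  (∀ t ∈ tr, V.IsConstrainedTrans t) ∧ ∃ s0 ∈ V.init, Chain s0 tr sf

/-- A state is constrained if some constrained trace reaches it. -/
def ConstrainedState (V : VLSM L S M) (s : S) : Prop :=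
  ∃ tr, V.ConstrainedTraceTo tr s

/-- Constrained reachability, defined inductively (a state is constrained iff it is
reachable from an initial state by constrained transitions). -/
inductive ReachState (V : VLSM L S M) : S → Prop where
  | init {s} : s ∈ V.init → ReachState V s
  | step {l s m} : ReachState V s → V.beta l s m → ReachState V (V.tau l s m).1

mutual
  /-- Valid states of a VLSM. -/
  inductive ValidState (V : VLSM L S M) : S → Prop where
    | init {s} : s ∈ V.init → ValidState V s
    | step {l s m} : ValidState V s → ValidOMsg V m → V.beta l s m →
        ValidState V (V.tau l s m).1
  /-- Valid optional messages of a VLSM (`none` is always valid). -/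
  inductive ValidOMsg (V : VLSM L S M) : Option M → Prop where
    | none : ValidOMsg V Option.none
    | init {m} : m ∈ V.initMsg → ValidOMsg V (some m)
    | step {l s m} : ValidState V s → ValidOMsg V m → V.beta l s m →
        ValidOMsg V (V.tau l s m).2
end

/-- `t` is a valid transition of `V`. -/
def IsValidTrans (V : VLSM L S M) (t : VTrans L S M) : Prop :=
  V.IsConstrainedTrans t ∧ V.ValidState t.src ∧ V.ValidOMsg t.msg

/-- `tr` is a valid trace of `V` reaching the state `sf`. -/
def ValidTraceTo (V : VLSM L S M) (tr : List (VTrans L S M)) (sf : S) : Prop :=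
  (∀ t ∈ tr, V.IsValidTrans t) ∧ ∃ s0 ∈ V.init, Chain s0 tr sf

/-- `tr` is a valid trace of `V`. -/
def IsValidTrace (V : VLSM L S M) (tr : List (VTrans L S M)) : Prop :=
  ∃ sf, V.ValidTraceTo tr sf

end VLSM

/-- The message `m` is emitted (sent) on the trace `tr`. -/
def EmittedOn (tr : List (VTrans L S M)) (m : M) : Prop := ∃ t ∈ tr, t.out = some m

/-- The message `m` is received on the trace `tr`. -/
def ReceivedOn (tr : List (VTrans L S M)) (m : M) : Prop := ∃ t ∈ tr, t.msg = some m

/-- `sent` is a sent-oracle for `V`: at every constrained state `s`, `sent s m` holds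
iff `m` is emitted on every constrained trace reaching `s`. -/
def IsSentOracle (V : VLSM L S M) (sent : S → M → Prop) : Prop :=
  ∀ s, V.ConstrainedState s → ∀ m,
    (sent s m ↔ ∀ tr, V.ConstrainedTraceTo tr s → EmittedOn tr m)

/-- `recv` is a received-oracle for `V`. -/
def IsReceivedOracle (V : VLSM L S M) (recv : S → M → Prop) : Prop :=
  ∀ s, V.ConstrainedState s → ∀ m,
    (recv s m ↔ ∀ tr, V.ConstrainedTraceTo tr s → ReceivedOn tr m)

/-- The full node assumption: whenever receiving `m` is allowed by the validity
constraint, every direct dependency of `m` has been directly observed in the state. -/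
def FullNodeAssumption (V : VLSM L S M) (dep : M → M → Prop)
    (sent recv : S → M → Prop) : Prop :=
  ∀ l s m, V.beta l s (some m) → ∀ m', dep m' m → sent s m' ∨ recv s m'

section Composition

variable {ι : Type*} [DecidableEq ι] {Lf : ι → Type*} {Sf : ι → Type*}

/-- The constrained composition of an indexed family of VLSMs over the same
message set, under the composition constraint `φ`. -/
noncomputable def comp (V : ∀ i, VLSM (Lf i) (Sf i) M)
    (φ : (Σ i, Lf i) → (∀ i, Sf i) → Option M → Prop) :
    VLSM (Σ i, Lf i) (∀ i, Sf i) M where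
  init := {σ | ∀ i, σ i ∈ (V i).init}
  init_ne := ⟨fun i => ((V i).init_ne).choose, fun i => ((V i).init_ne).choose_spec⟩
  initMsg := ⋃ i, (V i).initMsg
  tau := fun l σ m =>
    (Function.update σ l.1 ((V l.1).tau l.2 (σ l.1) m).1, ((V l.1).tau l.2 (σ l.1) m).2)
  beta := fun l σ m => (V l.1).beta l.2 (σ l.1) m ∧ φ l σ m

/-- The free composition of an indexed family of VLSMs over the same message set. -/
noncomputable def freeComp (V : ∀ i, VLSM (Lf i) (Sf i) M) :
    VLSM (Σ i, Lf i) (∀ i, Sf i) M :=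
  comp V fun _ _ _ => True

/-- Component `j` is a validator for the composite VLSM `W`: every constrained
transition from a constrained state of `V j` lifts to a valid transition of `W`
with matching `j`-th state components and matching input/output messages. -/
def IsValidatorAt (V : ∀ i, VLSM (Lf i) (Sf i) M)
    (W : VLSM (Σ i, Lf i) (∀ i, Sf i) M) (j : ι) : Prop :=
  ∀ l s m, (V j).ConstrainedState s → (V j).beta l s m →
    ∃ σ : ∀ i, Sf i, σ j = s ∧
      W.IsValidTrans ⟨⟨j, l⟩, σ, m, (W.tau ⟨j, l⟩ σ m).1, (W.tau ⟨j, l⟩ σ m).2⟩ ∧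
      (W.tau ⟨j, l⟩ σ m).1 j = ((V j).tau l s m).1 ∧
      (W.tau ⟨j, l⟩ σ m).2 = ((V j).tau l s m).2

/-- The induced `j`-th projection of a composite VLSM `W`: the same VLSM as the
component `Vj`, except that its initial messages are all valid messages of `W`. -/
def projV {L' : Type*} {S' : Type*} {L2 : Type*} {S2 : Type*}
    (Vj : VLSM L' S' M) (W : VLSM L2 S2 M) : VLSM L' S' M :=
  { Vj with initMsg := {m | W.ValidOMsg (some m)} }

/-- The projection of a composite trace on component `j`. -/
def projTrace (j : ι) (tr : List (VTrans (Σ i, Lf i) (∀ i, Sf i) M)) :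
    List (VTrans (Lf j) (Sf j) M) :=
  tr.filterMap fun t =>
    if h : t.lbl.1 = j then some ⟨h ▸ t.lbl.2, t.src j, t.msg, t.dst j, t.out⟩ else none

/-- The composition constraint of the fixed-set message-equivocation model:
the only message-equivocations allowed are among the components of `E`. -/
def phiM (sender : M → ι) (sent : ∀ i, Sf i → M → Prop) (E : Set ι) :
    (Σ i, Lf i) → (∀ i, Sf i) → Option M → Prop :=
  fun l σ m => ∀ mm, m = some mm →
    (sent (sender mm) (σ (sender mm)) mm ∨ (l.1 ∈ E ∧ sender mm ∈ E))

end Composition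

/-- Labels of the equivocating VLSM associated to a VLSM: act as the `i`-th copy,
duplicate the `i`-th copy, or spawn a new machine after position `i` (1-based). -/
inductive ELabel (L : Type u) (S : Type v) where
  | act (i : ℕ) (l : L)
  | dup (i : ℕ)
  | new (i : ℕ) (s : S)

/-- The equivocating VLSM associated to a VLSM `V`: its states are (nonempty) lists
of states of `V`, and it can fork itself or spawn fresh copies at any moment. -/
noncomputable def eVLSM (V : VLSM L S M) : VLSM (ELabel L S) (List S) M where
  init := {γ | ∃ s ∈ V.init, γ = [s]}
  init_ne := ⟨[V.init_ne.choose], V.init_ne.choose, V.init_ne.choose_spec, rfl⟩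
  initMsg := V.initMsg
  tau := fun lab γ m =>
    match lab with
    | .act i l =>
      match γ[i - 1]? with
      | some s => (γ.set (i - 1) (V.tau l s m).1, (V.tau l s m).2)
      | none => (γ, Option.none)
    | .dup i =>
      match γ[i - 1]? with
      | some s => (γ.take i ++ s :: γ.drop i, Option.none)
      | none => (γ, Option.none)
    | .new i s0 => (γ.take i ++ s0 :: γ.drop i, Option.none)
  beta := fun lab γ m =>
    match lab with
    | .act i l => 1 ≤ i ∧ i ≤ γ.length ∧ ∃ s, γ[i - 1]? = some s ∧ V.beta l s m
    | .dup i => 1 ≤ i ∧ i ≤ γ.length ∧ m = Option.none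
    | .new i s0 => 1 ≤ i ∧ i ≤ γ.length ∧ m = Option.none ∧ s0 ∈ V.init

/-- The two labels of UMO/MO/ELMO components. -/
inductive UL where
  | send
  | recv
deriving DecidableEq

/-- States (= messages) of UMO components: a finite list of message observations
together with an address. -/
inductive UState where
  | mk (obs : List (UL × UState)) (addr : ℕ)

/-- The list of message observations of a state. -/
def UState.obs : UState → List (UL × UState)
  | .mk o _ => o

/-- The address of a state. -/
def UState.addr : UState → ℕ
  | .mk _ i => i

/-- The set of messages observed as sent in a state. -/
def UState.sentMessages (s : UState) : Set UState := {m | (UL.send, m) ∈ s.obs}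

/-- The set of messages observed as received in a state. -/
def UState.receivedMessages (s : UState) : Set UState := {m | (UL.recv, m) ∈ s.obs}

/-- The set of messages observed in a state. -/
def UState.messages (s : UState) : Set UState := {m | ∃ l, (l, m) ∈ s.obs}

/-- The validity constraint of UMO components. -/
def betaUMO (l : UL) (_ : UState) (m : Option UState) : Prop :=
  (l = UL.send ∧ m = Option.none) ∨ (l = UL.recv ∧ m ≠ Option.none)

/-- The transition function of UMO (and MO, ELMO) components. -/
def tauUMO (l : UL) (s : UState) (m : Option UState) : UState × Option UState :=
  match l, m with
  | .send, Option.none => (UState.mk (s.obs ++ [(UL.send, s)]) s.addr, some s)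
  | .recv, some mm => (UState.mk (s.obs ++ [(UL.recv, mm)]) s.addr, Option.none)
  | _, _ => (s, m)

/-- The UMO component of address `i`. -/
noncomputable def UMO (i : ℕ) : VLSM UL UState UState where
  init := {UState.mk [] i}
  init_ne := ⟨UState.mk [] i, rfl⟩
  initMsg := ∅
  tau := tauUMO
  beta := betaUMO

/-- The UMO protocol: the free composition of the UMO components of addresses 1,…,n. -/
noncomputable def UMOProtocol (n : ℕ) : VLSM (Σ _ : Fin n, UL) (Fin n → UState) UState :=
  freeComp fun k : Fin n => UMO (k.1 + 1)

/-- The indirect message dependency relation on UMO states/messages: the least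
transitive relation with `m₁ < m₂` whenever `m₁ ∈ messages(m₂)`. -/
def mlt : UState → UState → Prop :=
  Relation.TransGen fun a b => a ∈ b.messages

/-- Two messages are incomparable: same sender (address), distinct, and neither is
(indirectly) observed in the other. -/
def Incomp (m m' : UState) : Prop :=
  m.addr = m'.addr ∧ m ≠ m' ∧ ¬ mlt m m' ∧ ¬ mlt m' m

open scoped Classical in
/-- Helper for `localEquivocatorsFull`, recursing over the reversed observation list. -/
noncomputable def lefAux : List (UL × UState) → Finset ℕ
  | [] => ∅
  | (l, m) :: rest =>
      if l = UL.recv ∧ ∃ m', (UL.recv, m') ∈ rest ∧ Incomp m m' then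
        insert m.addr (lefAux rest)
      else lefAux rest

/-- The set of locally evidenced equivocators in a state (full-node version):
`local_equivocators_full`. -/
noncomputable def localEquivocatorsFull (s : UState) : Finset ℕ :=
  lefAux s.obs.reverse

/-- The local equivocators of a state: addresses `j` for which there exist two
incomparable messages of address `j`, both observed in the state. -/
def localEquivUMO (s : UState) : Set ℕ :=
  {j | ∃ m m', m.addr = j ∧ m'.addr = j ∧ Incomp m m' ∧ mlt m s ∧ mlt m' s}

/-- The full node condition: all dependencies of the message have been observed. -/
def FullNodeU (s m : UState) : Prop := m.messages ⊆ s.messages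

/-- No self-equivocation: a message with the component's own address must have
been sent by the component. -/
def NoSelfEquiv (s m : UState) : Prop :=
  m.addr = s.addr → (UL.send, m) ∈ s.obs

/-- The message-validity predicate `ψ_msg_valid_full` of ELMO components, as an
inductive predicate capturing its recursive definition on the last observation. -/
inductive MsgValidFull (n : ℕ) : UState → Prop where
  | nil {j} : 1 ≤ j → j ≤ n → MsgValidFull n (.mk [] j)
  | snocSend {o j} : MsgValidFull n (.mk o j) →
      MsgValidFull n (.mk (o ++ [(UL.send, .mk o j)]) j)
  | snocRecv {o j mp} : MsgValidFull n (.mk o j) →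
      FullNodeU (.mk o j) mp → NoSelfEquiv (.mk o j) mp →
      MsgValidFull n (.mk (o ++ [(UL.recv, mp)]) j)

/-- The receive-validity predicate `ψ_ELMO` of ELMO components. -/
noncomputable def psiELMO (n : ℕ) (w : ℕ → ℝ) (t : ℝ) (s m : UState) : Prop :=
  FullNodeU s m ∧ MsgValidFull n m ∧ NoSelfEquiv s m ∧
    (∑ j ∈ localEquivocatorsFull (UState.mk (s.obs ++ [(UL.recv, m)]) s.addr), w j) < t

/-- The ELMO component of address `i`, with threshold `t` and weight function `w`. -/
noncomputable def ELMO (n : ℕ) (w : ℕ → ℝ) (t : ℝ) (i : ℕ) : VLSM UL UState UState :=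
  { UMO i with
    beta := fun l s m =>
      betaUMO l s m ∧ (l = UL.recv → ∀ mm, m = some mm → psiELMO n w t s mm) }

open scoped Classical in
/-- The messages observed in some component of a composite state, as a finite set. -/
noncomputable def compObsMsgs {n : ℕ} (σ : Fin n → UState) : Finset UState :=
  Finset.univ.biUnion fun k => ((σ k).obs.map Prod.snd).toFinset

open scoped Classical in
/-- `global_equivocators_full`: addresses of messages observed in some component of
the composite state but observed as sent in no component. -/
noncomputable def globalEquivocatorsFull {n : ℕ} (σ : Fin n → UState) : Finset ℕ :=
  ((compObsMsgs σ).filter fun m => ∀ k, (UL.send, m) ∉ (σ k).obs).image UState.addr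

/-- The composition constraint `φ_ELMO` of the ELMO protocol: upon a receive
transition, the total weight of globally evidenced (full-node) equivocators in the
resulting composite state stays below the threshold. -/
noncomputable def phiELMO (n : ℕ) (w : ℕ → ℝ) (t : ℝ) :
    (Σ _ : Fin n, UL) → (Fin n → UState) → Option UState → Prop :=
  fun l σ m => l.2 = UL.recv →
    (∑ j ∈ globalEquivocatorsFull
        (Function.update σ l.1 ((ELMO n w t (l.1.1 + 1)).tau l.2 (σ l.1) m).1), w j) < t

/-- The ELMO protocol: the constrained composition of the ELMO components of
addresses 1,…,n under `φ_ELMO`. -/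
noncomputable def ELMOProtocol (n : ℕ) (w : ℕ → ℝ) (t : ℝ) :
    VLSM (Σ _ : Fin n, UL) (Fin n → UState) UState :=
  comp (fun k : Fin n => ELMO n w t (k.1 + 1)) (phiELMO n w t)

theorem Incomp.symm {m m' : UState} (h : Incomp m m') : Incomp m' m :=
  ⟨h.1.symm, h.2.1.symm, h.2.2.2, h.2.2.1⟩

theorem mem_lefAux {j : ℕ} (l : List (UL × UState)) :
    j ∈ lefAux l ↔
      ∃ m m', (UL.recv, m) ∈ l ∧ (UL.recv, m') ∈ l ∧ Incomp m m' ∧ m.addr = j := by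
  induction l with
  | nil => simp [lefAux]
  | cons x rest ih =>
    obtain ⟨l, a⟩ := x
    rw [lefAux]
    constructor
    · intro h
      split_ifs at h with hc
      · rcases Finset.mem_insert.1 h with rfl | h
        · obtain ⟨rfl, m', hm', hi⟩ := hc
          exact ⟨a, m', List.mem_cons_self, List.mem_cons_of_mem _ hm', hi, rfl⟩
        · obtain ⟨m, m', h1, h2, h3⟩ := ih.1 h
          exact ⟨m, m', List.mem_cons_of_mem _ h1, List.mem_cons_of_mem _ h2, h3⟩
      · obtain ⟨m, m', h1, h2, h3⟩ := ih.1 h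
        exact ⟨m, m', List.mem_cons_of_mem _ h1, List.mem_cons_of_mem _ h2, h3⟩
    · rintro ⟨m, m', h1, h2, hi, hj⟩
      rcases List.mem_cons.1 h1 with e1 | k1 <;> rcases List.mem_cons.1 h2 with e2 | k2
      · cases e1
        cases e2
        exact absurd rfl hi.2.1
      · cases e1
        rw [if_pos ⟨rfl, m', k2, hi⟩, ← hj]
        exact Finset.mem_insert_self _ _
      · cases e2
        rw [if_pos ⟨rfl, m, k1, hi.symm⟩, ← hj, hi.1]
        exact Finset.mem_insert_self _ _
      · have h := ih.2 ⟨m, m', k1, k2, hi, hj⟩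
        split_ifs
        · exact Finset.mem_insert_of_mem h
        · exact h

theorem mem_localEquivocatorsFull {j : ℕ} (s : UState) :
    j ∈ localEquivocatorsFull s ↔
      ∃ m m', m ∈ s.receivedMessages ∧ m' ∈ s.receivedMessages ∧ Incomp m m' ∧ m.addr = j := by
  simp [localEquivocatorsFull, mem_lefAux, UState.receivedMessages]

/-- The properties of the observations of a constrained ELMO state that force local evidence of
equivocation to come from received messages. -/
structure UState.Coherent (s : UState) : Prop where
  messages_subset : ∀ m ∈ s.messages, m.messages ⊆ s.messages
  addr_of_sent : ∀ m ∈ s.sentMessages, m.addr = s.addr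
  sent_comparable : ∀ m ∈ s.sentMessages, ∀ m' ∈ s.sentMessages, m = m' ∨ mlt m m' ∨ mlt m' m
  sent_of_received : ∀ m ∈ s.receivedMessages, m.addr = s.addr → m ∈ s.sentMessages

namespace UState.Coherent

theorem nil (i : ℕ) : (UState.mk [] i).Coherent := by
  constructor <;> simp [UState.messages, UState.sentMessages, UState.receivedMessages, UState.obs]

theorem send {s : UState} (h : s.Coherent) :
    (UState.mk (s.obs ++ [(UL.send, s)]) s.addr).Coherent := by
  have hmsg : ∀ x, x ∈ (UState.mk (s.obs ++ [(UL.send, s)]) s.addr).messages ↔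
      x ∈ s.messages ∨ x = s := by
    intro x
    simp [UState.messages, UState.obs, exists_or]
  have hsent : ∀ x, x ∈ (UState.mk (s.obs ++ [(UL.send, s)]) s.addr).sentMessages ↔
      x ∈ s.sentMessages ∨ x = s := by
    intro x
    simp [UState.sentMessages, UState.obs]
  have hrecv : ∀ x, x ∈ (UState.mk (s.obs ++ [(UL.send, s)]) s.addr).receivedMessages ↔
      x ∈ s.receivedMessages := by
    intro x
    simp [UState.receivedMessages, UState.obs]
  have hlt : ∀ x ∈ s.sentMessages, mlt x s := fun x hx => .single ⟨_, hx⟩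
  constructor
  · intro m hm x hx
    rw [hmsg] at hm ⊢
    rcases hm with hm | rfl
    · exact .inl (h.messages_subset m hm hx)
    · exact .inl hx
  · intro m hm
    rcases (hsent m).1 hm with hm | rfl
    · exact h.addr_of_sent m hm
    · rfl
  · intro m hm m' hm'
    rcases (hsent m).1 hm with hm | rfl <;> rcases (hsent m').1 hm' with hm' | rfl
    · exact h.sent_comparable m hm m' hm'
    · exact .inr (.inl (hlt m hm))
    · exact .inr (.inr (hlt m' hm'))
    · exact .inl rfl
  · intro m hm ha
    exact (hsent m).2 (.inl (h.sent_of_received m ((hrecv m).1 hm) ha))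

theorem recv {s a : UState} (h : s.Coherent) (hfull : FullNodeU s a) (hself : NoSelfEquiv s a) :
    (UState.mk (s.obs ++ [(UL.recv, a)]) s.addr).Coherent := by
  have hmsg : ∀ x, x ∈ (UState.mk (s.obs ++ [(UL.recv, a)]) s.addr).messages ↔
      x ∈ s.messages ∨ x = a := by
    intro x
    simp [UState.messages, UState.obs, exists_or]
  have hsent : ∀ x, x ∈ (UState.mk (s.obs ++ [(UL.recv, a)]) s.addr).sentMessages ↔
      x ∈ s.sentMessages := by
    intro x
    simp [UState.sentMessages, UState.obs]
  have hrecv : ∀ x, x ∈ (UState.mk (s.obs ++ [(UL.recv, a)]) s.addr).receivedMessages ↔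
      x ∈ s.receivedMessages ∨ x = a := by
    intro x
    simp [UState.receivedMessages, UState.obs]
  constructor
  · intro m hm x hx
    rw [hmsg] at hm ⊢
    rcases hm with hm | rfl
    · exact .inl (h.messages_subset m hm hx)
    · exact .inl (hfull hx)
  · intro m hm
    exact h.addr_of_sent m ((hsent m).1 hm)
  · intro m hm m' hm'
    exact h.sent_comparable m ((hsent m).1 hm) m' ((hsent m').1 hm')
  · intro m hm ha
    rw [hsent]
    rcases (hrecv m).1 hm with hm | rfl
    · exact h.sent_of_received m hm ha
    · exact hself ha

theorem mem_messages_of_mlt {s m : UState} (h : s.Coherent) (hm : mlt m s) : m ∈ s.messages := by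
  induction hm using Relation.TransGen.head_induction_on with
  | single hab => exact hab
  | head hab _ ih => exact h.messages_subset _ ih hab

theorem not_incomp_of_sent {s m m' : UState} (h : s.Coherent) (hm : m ∈ s.sentMessages)
    (hm' : m' ∈ s.messages) : ¬ Incomp m m' := by
  intro hi
  have hsent' : m' ∈ s.sentMessages := by
    obtain ⟨l, hl⟩ := hm'
    cases l with
    | send => exact hl
    | recv => exact h.sent_of_received m' hl (hi.1.symm.trans (h.addr_of_sent m hm))
  rcases h.sent_comparable m hm m' hsent' with he | hlt | hlt
  · exact hi.2.1 he
  · exact hi.2.2.1 hlt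
  · exact hi.2.2.2 hlt

theorem received_of_incomp {s m m' : UState} (h : s.Coherent) (hm : m ∈ s.messages)
    (hm' : m' ∈ s.messages) (hi : Incomp m m') : m ∈ s.receivedMessages := by
  obtain ⟨l, hl⟩ := hm
  cases l with
  | send => exact absurd hi (h.not_incomp_of_sent hl hm')
  | recv => exact hl

theorem localEquivUMO_eq {s : UState} (h : s.Coherent) :
    localEquivUMO s = ↑(localEquivocatorsFull s) := by
  ext j
  rw [Finset.mem_coe, mem_localEquivocatorsFull]
  constructor
  · rintro ⟨m, m', hj, -, hi, hm, hm'⟩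
    have hm := h.mem_messages_of_mlt hm
    have hm' := h.mem_messages_of_mlt hm'
    exact ⟨m, m', h.received_of_incomp hm hm' hi, h.received_of_incomp hm' hm hi.symm, hi, hj⟩
  · rintro ⟨m, m', hm, hm', hi, hj⟩
    exact ⟨m, m', hj, hi.1.symm.trans hj, hi, .single ⟨_, hm⟩, .single ⟨_, hm'⟩⟩

end UState.Coherent

theorem VLSM.ReachState.coherent {n : ℕ} {w : ℕ → ℝ} {t : ℝ} {i : ℕ} {s : UState}
    (hs : (ELMO n w t i).ReachState s) : s.Coherent := by
  induction hs with
  | init h =>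
    rw [Set.mem_singleton_iff.1 h]
    exact .nil i
  | @step l s m _ hb ih =>
    obtain ⟨⟨rfl, rfl⟩ | ⟨rfl, hm⟩, hpsi⟩ := hb
    · exact ih.send
    · obtain ⟨a, rfl⟩ := Option.ne_none_iff_exists'.1 hm
      obtain ⟨hfull, -, hself, -⟩ := hpsi rfl a rfl
      exact ih.recv hfull hself

/-- For any constrained state of an ELMO component, the two notions of local
evidence of equivocation coincide. -/
theorem local_equivocators_iff_full (n : ℕ) (w : ℕ → ℝ)
    (hw : ∀ j, 1 ≤ j → j ≤ n → 0 < w j) (t : ℝ) (ht : 0 < t)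
    (i : ℕ) (s : UState) (hs : (ELMO n w t i).ReachState s) :
    localEquivUMO s = ↑(localEquivocatorsFull s) :=
  hs.coherent.localEquivUMO_eq
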